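/- arXiv:2408.16385 — 2 statements merged into one kernel-verified Lean document; each statement's English description precedes it below -/
import Mathlib

section
/- Let x̄ ∈ ℝ and let Y : [0,∞) → ℝ be a measurable path with Y_0 ≤ x̄ such that its running supremum Ȳ_t = max(x̄, sup_{0≤s≤t} Y_s) is finite-valued and continuous in t. Let H : [0,∞) → ℝ be a bounded measurable function with H_s ≤ 1 for all s, and define U_t = Y_t − ∫_{(0,t]} H_s dȲ_s. Then for all t ≥ 0, max(x̄, sup_{0≤s≤t} U_s) = Ȳ_t − ∫_{(0,t]} H_s dȲ_s. (Lemma 3.1.) -/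
open MeasureTheory Set Filter Function

noncomputable section

/-- Running supremum of a path over `[0, t]`. -/
def runSSup (Z : ℝ → ℝ) (t : ℝ) : ℝ := sSup (Z '' Set.Icc 0 t)

/-- Running supremum of a path with initial maximum level `xbar`. -/
def runSup (xbar : ℝ) (Z : ℝ → ℝ) (t : ℝ) : ℝ := max xbar (runSSup Z t)

/-- Skorokhod regulator at 0. -/
def Psi (Y : ℝ → ℝ) (t : ℝ) : ℝ := max 0 (-(sInf (Y '' Set.Icc 0 t)))

/-- Reflection of a path at 0 from below. -/
def Phi (Y : ℝ → ℝ) (t : ℝ) : ℝ := Y t + Psi Y t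

/-- A path, viewed on `[0,∞)`, is càdlàg: right-continuous at every `t ≥ 0` and
with left limits at every `t > 0`. -/
def Cadlag (Z : ℝ → ℝ) : Prop :=
  (∀ t : ℝ, 0 ≤ t → ContinuousWithinAt Z (Set.Ici t) t) ∧
  (∀ t : ℝ, 0 < t → ∃ l : ℝ, Filter.Tendsto Z (nhdsWithin t (Set.Iio t)) (nhds l))

/-- A càdlàg path has no positive jumps if `ΔZ_t = Z_t - Z_{t-} ≤ 0` for all `t > 0`. -/
def NoPosJumps (Z : ℝ → ℝ) : Prop :=
  ∀ t : ℝ, 0 < t → Z t ≤ Function.leftLim Z t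

/-- Lebesgue–Stieltjes measure of an increasing right-continuous path on `[0,∞)`,
without the atom at `0`. -/
def lsMeasureAux (f : ℝ → ℝ) : Measure ℝ := by
  classical
  exact if h : Monotone (fun t => f (max t 0)) ∧
      ∀ x : ℝ, ContinuousWithinAt (fun t => f (max t 0)) (Set.Ici x) x then
    StieltjesFunction.measure ⟨fun t => f (max t 0), h.1, h.2⟩
  else 0

/-- Lebesgue–Stieltjes measure of an increasing right-continuous path on `[0,∞)`,
with an atom of mass `f 0` at `0`. -/
def lsMeasure (f : ℝ → ℝ) : Measure ℝ :=
  lsMeasureAux f + (ENNReal.ofReal (f 0)) • Measure.dirac 0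

/-- `(V, K)` is a tax-reflection pair for `(X, δ, xbar)`. -/
def IsTaxReflectionPair (δ : ℝ → ℝ) (X : ℝ → ℝ) (xbar : ℝ) (V K : ℝ → ℝ) : Prop :=
  Cadlag V ∧ Cadlag K ∧
  (∀ t : ℝ, 0 ≤ t → 0 ≤ V t) ∧
  MonotoneOn K (Set.Ici 0) ∧
  (∀ t : ℝ, 0 ≤ t →
    V t = X t + K t -
      ∫ s in Set.Ioc (0:ℝ) t, δ (V s)
        ∂(lsMeasure (runSup xbar (fun s => X s + K s)))) ∧
  lsMeasure K {t : ℝ | 0 ≤ t ∧ 0 < V t} = 0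

/-- A solution of the ODE `y' = 1 - δ(y)`, `y(0) = y₀`, on `[0,∞)`. -/
def IsFlow (δ : ℝ → ℝ) (y₀ : ℝ) (y : ℝ → ℝ) : Prop :=
  ContinuousOn y (Set.Ici 0) ∧
  ∀ t : ℝ, 0 ≤ t → y t = y₀ + ∫ s in (0:ℝ)..t, (1 - δ (y s))

/-- `δ` admits a unique flow: for every `y₀ ≥ 0` the ODE `y' = 1 - δ(y)`, `y(0) = y₀`
has exactly one continuous solution on `[0,∞)`. -/
def AdmitsUniqueFlow (δ : ℝ → ℝ) : Prop :=
  ∀ y₀ : ℝ, 0 ≤ y₀ →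
    (∃ y : ℝ → ℝ, IsFlow δ y₀ y) ∧
    ∀ y z : ℝ → ℝ, IsFlow δ y₀ y → IsFlow δ y₀ z → ∀ t : ℝ, 0 ≤ t → y t = z t

lemma runSup_monotoneOn (xbar : ℝ) {Y : ℝ → ℝ}
    (hY : ∀ t : ℝ, 0 ≤ t → BddAbove (Y '' Set.Icc 0 t)) :
    MonotoneOn (runSup xbar Y) (Set.Ici 0) := fun _ hs t ht hst =>
  max_le_max le_rfl <| csSup_le_csSup (hY t ht) ((Set.nonempty_Icc.2 hs).image Y)
    (Set.image_mono (Set.Icc_subset_Icc_right hst))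

lemma le_runSup (xbar : ℝ) {Y : ℝ → ℝ} {s t : ℝ} (hY : BddAbove (Y '' Set.Icc 0 t))
    (hs : s ∈ Set.Icc 0 t) : Y s ≤ runSup xbar Y t :=
  (le_csSup hY (Set.mem_image_of_mem Y hs)).trans (le_max_right _ _)

lemma runSup_le {xbar : ℝ} {Y : ℝ → ℝ} {t b : ℝ} (ht : 0 ≤ t) (hx : xbar ≤ b)
    (hb : ∀ s ∈ Set.Icc 0 t, Y s ≤ b) : runSup xbar Y t ≤ b :=
  max_le hx <| csSup_le ((Set.nonempty_Icc.2 ht).image Y) (Set.forall_mem_image.2 hb)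

lemma runSup_zero {xbar : ℝ} {Y : ℝ → ℝ} (hY0 : Y 0 ≤ xbar) : runSup xbar Y 0 = xbar := by
  simp [runSup, runSSup, hY0]

lemma lsMeasure_Ioc {f : ℝ → ℝ} (hmono : MonotoneOn f (Set.Ici 0))
    (hcont : ContinuousOn f (Set.Ici 0)) {s t : ℝ} (hs : 0 ≤ s) (ht : 0 ≤ t) :
    lsMeasure f (Set.Ioc s t) = ENNReal.ofReal (f t - f s) := by
  have hmax (x : ℝ) : max x 0 ∈ Set.Ici (0 : ℝ) := Set.mem_Ici.2 (le_max_right x 0)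
  have hm : Monotone fun t => f (max t 0) := fun a b hab =>
    hmono (hmax a) (hmax b) (max_le_max hab le_rfl)
  have hc : Continuous fun t => f (max t 0) :=
    hcont.comp_continuous (by fun_prop) hmax
  rw [lsMeasure, lsMeasureAux, dif_pos ⟨hm, fun x => hc.continuousWithinAt⟩]
  simp [StieltjesFunction.measure_Ioc, hs, ht, hs.not_gt]

/-- Increments of `∫ H` against a Lebesgue–Stieltjes measure are dominated by those of the
integrator. -/
lemma setIntegral_lsMeasure_sub_bounds {f H : ℝ → ℝ} (hmono : MonotoneOn f (Set.Ici 0))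
    (hcont : ContinuousOn f (Set.Ici 0)) (hH : Measurable H) {C : ℝ} (hC : ∀ s, |H s| ≤ C)
    (hH1 : ∀ s, H s ≤ 1) {s t : ℝ} (hs : 0 ≤ s) (hst : s ≤ t) :
    ((∫ r in Set.Ioc 0 t, H r ∂lsMeasure f) - ∫ r in Set.Ioc 0 s, H r ∂lsMeasure f)
        ≤ f t - f s ∧
      -(C * (f t - f s)) ≤
        (∫ r in Set.Ioc 0 t, H r ∂lsMeasure f) - ∫ r in Set.Ioc 0 s, H r ∂lsMeasure f := by
  have hfin : ∀ {a b : ℝ}, 0 ≤ a → 0 ≤ b → lsMeasure f (Set.Ioc a b) < ⊤ := fun ha hb => by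
    rw [lsMeasure_Ioc hmono hcont ha hb]; exact ENNReal.ofReal_lt_top
  have hint : ∀ {a b : ℝ}, 0 ≤ a → 0 ≤ b → IntegrableOn H (Set.Ioc a b) (lsMeasure f) :=
    fun ha hb => IntegrableOn.of_bound (hfin ha hb) hH.aestronglyMeasurable C
      (Eventually.of_forall hC)
  have ht : 0 ≤ t := hs.trans hst
  have hreal : (lsMeasure f).real (Set.Ioc s t) = f t - f s := by
    rw [Measure.real, lsMeasure_Ioc hmono hcont hs ht,
      ENNReal.toReal_ofReal (sub_nonneg.2 (hmono hs ht hst))]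
  have hsplit : (∫ r in Set.Ioc 0 t, H r ∂lsMeasure f) - ∫ r in Set.Ioc 0 s, H r ∂lsMeasure f
      = ∫ r in Set.Ioc s t, H r ∂lsMeasure f := by
    rw [← Set.Ioc_union_Ioc_eq_Ioc hs hst, setIntegral_union
      (Set.Ioc_disjoint_Ioc_of_le le_rfl) measurableSet_Ioc (hint le_rfl hs) (hint hs ht)]
    ring
  rw [hsplit, ← hreal]
  constructor
  · have h := setIntegral_mono (hint hs ht)
      (integrableOn_const (C := (1 : ℝ)) (hfin hs ht).ne) hH1
    simpa using h
  · have h := norm_setIntegral_le_of_norm_le_const (f := H) (C := C) (hfin hs ht) fun r _ => hC r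
    exact (abs_le.1 h).1

/-- **Lemma 3.1.** -/
theorem running_sup_of_taxed_process
    (xbar : ℝ) (Y : ℝ → ℝ) (hYmeas : Measurable Y) (hY0 : Y 0 ≤ xbar)
    (hYbdd : ∀ t : ℝ, 0 ≤ t → BddAbove (Y '' Set.Icc 0 t))
    (hcont : ContinuousOn (runSup xbar Y) (Set.Ici 0))
    (H : ℝ → ℝ) (hHmeas : Measurable H)
    (hHbdd : ∃ C : ℝ, ∀ s : ℝ, |H s| ≤ C)
    (hH1 : ∀ s : ℝ, H s ≤ 1)
    (U : ℝ → ℝ)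
    (hU : ∀ t : ℝ, U t = Y t - ∫ s in Set.Ioc (0:ℝ) t, H s ∂(lsMeasure (runSup xbar Y))) :
    ∀ t : ℝ, 0 ≤ t →
      runSup xbar U t
        = runSup xbar Y t - ∫ s in Set.Ioc (0:ℝ) t, H s ∂(lsMeasure (runSup xbar Y)) := by
  obtain ⟨C, hC⟩ := hHbdd
  intro t ht
  have hmono := runSup_monotoneOn xbar hYbdd
  have hM0 := runSup_zero hY0
  set M := runSup xbar Y
  set I : ℝ → ℝ := fun t => ∫ s in Set.Ioc (0:ℝ) t, H s ∂(lsMeasure M)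
  change ∀ t, U t = Y t - I t at hU
  have hinc : ∀ s ∈ Set.Icc 0 t, I t - I s ≤ M t - M s ∧ -(C * (M t - M s)) ≤ I t - I s :=
    fun s hs => setIntegral_lsMeasure_sub_bounds hmono hcont hHmeas hC hH1 hs.1 hs.2
  have h0 := hinc 0 ⟨le_rfl, ht⟩
  have hI0 : I 0 = 0 := by simp [I]
  rw [hM0, hI0] at h0
  change runSup xbar U t = M t - I t
  have hUle : ∀ s ∈ Set.Icc 0 t, U s ≤ M t - I t := fun s hs => by
    have hYs : Y s ≤ M s := le_runSup xbar (hYbdd s hs.1) ⟨hs.1, le_rfl⟩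
    linarith [hU s, (hinc s hs).1]
  have hUbdd : BddAbove (U '' Set.Icc 0 t) := ⟨_, Set.forall_mem_image.2 hUle⟩
  refine le_antisymm (runSup_le ht (by linarith [h0.1]) hUle) ?_
  have hC0 : 0 ≤ C := (abs_nonneg _).trans (hC 0)
  have hx : xbar ≤ runSup xbar U t := le_max_left _ _
  rcases max_choice xbar (runSSup Y t) with hM | hM
  · have hMt : M t = xbar := hM
    rw [hMt] at h0 ⊢
    linarith [h0.2]
  · have hMt : M t = sSup (Y '' Set.Icc 0 t) := hM
    have hlim : ∀ ε > 0, M t - I t ≤ runSup xbar U t + (1 + C) * ε := fun ε hε => by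
      obtain ⟨_, ⟨s, hs, rfl⟩, hlt⟩ := exists_lt_of_lt_csSup
        ((Set.nonempty_Icc.2 ht).image Y) (show M t - ε < sSup (Y '' Set.Icc 0 t) by linarith)
      have hYs : Y s ≤ M s := le_runSup xbar (hYbdd s hs.1) ⟨hs.1, le_rfl⟩
      have hUs := le_runSup xbar hUbdd hs
      have hCε : C * (M t - M s) ≤ C * ε := mul_le_mul_of_nonneg_left (by linarith) hC0
      linarith [hU s, (hinc s hs).2]
    refine le_of_forall_pos_le_add fun ε hε => ?_
    have h := hlim (ε / (1 + C)) (by positivity)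
    rwa [mul_div_cancel₀ _ (by positivity)] at h

end
end

section
/- Let δ : [0,∞) → [0,1) be measurable, let X be a càdlàg path with no positive jumps, let x̄ ≥ max(X_0, 0), and let (V⁺, K⁺) be a tax-reflection pair for (X, δ, x̄). Then for every t > 0 with ΔK⁺_t > 0 one has V⁺_t = 0 and ΔX_t + ΔK⁺_t = −V⁺_{t−} ≤ 0. Consequently the path X + K⁺ has no positive jumps, and its running supremum with initial maximum level x̄ is continuous. -/
open MeasureTheory Set Filter Function

noncomputable section

namespace Cadlag

variable {Y Z : ℝ → ℝ}

lemma add (hY : Cadlag Y) (hZ : Cadlag Z) : Cadlag (fun t => Y t + Z t) := by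
  refine ⟨fun t ht => (hY.1 t ht).add (hZ.1 t ht), fun t ht => ?_⟩
  obtain ⟨a, ha⟩ := hY.2 t ht
  obtain ⟨b, hb⟩ := hZ.2 t ht
  exact ⟨a + b, ha.add hb⟩

lemma tendsto_leftLim (hZ : Cadlag Z) {t : ℝ} (ht : 0 < t) :
    Tendsto Z (nhdsWithin t (Iio t)) (nhds (leftLim Z t)) :=
  tendsto_leftLim_of_tendsto (hZ.2 t ht)

lemma leftLim_add (hY : Cadlag Y) (hZ : Cadlag Z) {t : ℝ} (ht : 0 < t) :
    leftLim (fun s => Y s + Z s) t = leftLim Y t + leftLim Z t :=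
  leftLim_eq_of_tendsto ((hY.tendsto_leftLim ht).add (hZ.tendsto_leftLim ht))

lemma bddAbove_image_Icc (hZ : Cadlag Z) (T : ℝ) : BddAbove (Z '' Icc 0 T) := by
  refine isCompact_Icc.induction_on (p := fun s => BddAbove (Z '' s)) (by simp)
    (fun s t hst ht => ht.mono (image_mono hst))
    (fun s t hs ht => by rw [image_union]; exact hs.union ht) fun x hx => ?_
  have hbound : ∀ {l : Filter ℝ} {a : ℝ}, Tendsto Z l (nhds a) → ∀ᶠ y in l, Z y ≤ a + 1 :=
    fun h => (h.eventually_lt_const (lt_add_one _)).mono fun _ => le_of_lt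
  suffices h : ∃ c, ∀ᶠ y in nhdsWithin x (Icc 0 T), Z y ≤ c by
    obtain ⟨c, hc⟩ := h
    exact ⟨{y | Z y ≤ c}, hc, c, by rintro _ ⟨y, hy, rfl⟩; exact hy⟩
  have hr := hbound (hZ.1 x hx.1)
  rcases hx.1.eq_or_lt with rfl | hx0
  · exact ⟨_, hr.filter_mono (nhdsWithin_mono _ fun y hy => hy.1)⟩
  · have hl := hbound (hZ.tendsto_leftLim hx0)
    refine ⟨max (leftLim Z x + 1) (Z x + 1), Eventually.filter_mono nhdsWithin_le_nhds ?_⟩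
    rw [← nhdsLT_sup_nhdsGE, eventually_sup]
    exact ⟨hl.mono fun y hy => le_max_of_le_left hy, hr.mono fun y hy => le_max_of_le_right hy⟩

end Cadlag

section RunSup

variable {Z : ℝ → ℝ} {xbar s t : ℝ}

lemma runSup_le_iff (hZ : Cadlag Z) (ht : 0 ≤ t) {c : ℝ} :
    runSup xbar Z t ≤ c ↔ xbar ≤ c ∧ ∀ s ∈ Icc 0 t, Z s ≤ c := by
  rw [runSup, max_le_iff, runSSup, csSup_le_iff (hZ.bddAbove_image_Icc t)
    ((nonempty_Icc.2 ht).image Z), forall_mem_image]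

lemma le_runSup_s10 (hZ : Cadlag Z) (hs : 0 ≤ s) (hst : s ≤ t) : Z s ≤ runSup xbar Z t :=
  ((runSup_le_iff hZ (hs.trans hst)).1 le_rfl).2 s ⟨hs, hst⟩

lemma monotoneOn_runSup (hZ : Cadlag Z) : MonotoneOn (runSup xbar Z) (Ici 0) :=
  fun _ hs _ _ hst => (runSup_le_iff hZ hs).2
    ⟨le_max_left _ _, fun _ hr => le_runSup_s10 hZ hr.1 (hr.2.trans hst)⟩

lemma continuousWithinAt_runSup_Ici (hZ : Cadlag Z) (ht : 0 ≤ t) :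
    ContinuousWithinAt (runSup xbar Z) (Ici t) t := by
  refine tendsto_order.2 ⟨fun a ha => ?_, fun b hb => ?_⟩
  · filter_upwards [self_mem_nhdsWithin] with s hs
    exact ha.trans_le (monotoneOn_runSup hZ ht (ht.trans hs) hs)
  · obtain ⟨c, hc, hcb⟩ := exists_between hb
    have hZc : ∀ᶠ s in nhdsWithin t (Ici t), Z s < c :=
      (hZ.1 t ht).eventually_lt_const ((le_runSup_s10 hZ ht le_rfl).trans_lt hc)
    obtain ⟨u, hu, hsub⟩ := mem_nhdsGE_iff_exists_Ico_subset.1 hZc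
    filter_upwards [Ico_mem_nhdsGE hu] with s hs
    refine ((runSup_le_iff hZ (ht.trans hs.1)).2 ⟨?_, fun r hr => ?_⟩).trans_lt hcb
    · exact (le_max_left _ _).trans hc.le
    · rcases le_total r t with hrt | hrt
      · exact (le_runSup_s10 hZ hr.1 hrt).trans hc.le
      · exact (hsub ⟨hrt, hr.2.trans_lt hs.2⟩ : Z r < c).le

end RunSup

/-- The Stieltjes function on `ℝ` which extends a path that is increasing and right-continuous
on `[0,∞)`. -/
def pathStieltjes (f : ℝ → ℝ) (hm : MonotoneOn f (Ici 0))
    (hc : ∀ t : ℝ, 0 ≤ t → ContinuousWithinAt f (Ici t) t) : StieltjesFunction ℝ where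
  toFun t := f (max t 0)
  mono' _ _ h :=
    hm (mem_Ici.2 (le_max_right _ _)) (mem_Ici.2 (le_max_right _ _)) (max_le_max_right 0 h)
  right_continuous' x := (hc (max x 0) (le_max_right _ _)).comp (t := Ici (max x 0))
    (by fun_prop) fun y (hy : x ≤ y) => mem_Ici.2 (max_le_max_right 0 hy)

section PathStieltjes

variable {f : ℝ → ℝ} (hm : MonotoneOn f (Ici 0))
  (hc : ∀ t : ℝ, 0 ≤ t → ContinuousWithinAt f (Ici t) t)

lemma pathStieltjes_apply {t : ℝ} (ht : 0 ≤ t) : pathStieltjes f hm hc t = f t :=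
  congrArg f (max_eq_left ht)

lemma tendsto_leftLim_pathStieltjes {t : ℝ} (ht : 0 < t) :
    Tendsto f (nhdsWithin t (Iio t)) (nhds (leftLim (pathStieltjes f hm hc) t)) := by
  refine ((pathStieltjes f hm hc).mono.tendsto_leftLim t).congr' ?_
  filter_upwards [Ioo_mem_nhdsLT ht] with s hs
  exact pathStieltjes_apply hm hc hs.1.le

lemma lsMeasureAux_eq : lsMeasureAux f = (pathStieltjes f hm hc).measure :=
  dif_pos ⟨(pathStieltjes f hm hc).mono, (pathStieltjes f hm hc).right_continuous⟩

lemma restrict_lsMeasure {s : Set ℝ} (hs : MeasurableSet s) (h0 : (0 : ℝ) ∉ s) :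
    (lsMeasure f).restrict s = (pathStieltjes f hm hc).measure.restrict s := by
  classical
  rw [lsMeasure, lsMeasureAux_eq hm hc, Measure.restrict_add, Measure.restrict_smul,
    restrict_dirac' hs, if_neg h0, smul_zero, add_zero]

end PathStieltjes

/-- A real function which is right-continuous everywhere is Borel measurable. -/
lemma measurable_of_continuousWithinAt_Ici {f : ℝ → ℝ}
    (hf : ∀ x, ContinuousWithinAt f (Ici x) x) : Measurable f := by
  have happrox : ∀ x : ℝ, Tendsto (fun n : ℕ => ((⌈x * (n + 1)⌉ : ℤ) : ℝ) / (n + 1)) atTop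
      (nhdsWithin x (Ici x)) := by
    intro x
    have hpos : ∀ n : ℕ, (0 : ℝ) < n + 1 := fun n => by positivity
    have hle : ∀ n : ℕ, x ≤ ((⌈x * (n + 1)⌉ : ℤ) : ℝ) / (n + 1) := fun n => by
      rw [le_div_iff₀ (hpos n)]
      exact Int.le_ceil _
    refine tendsto_nhdsWithin_iff.2 ⟨?_, Eventually.of_forall hle⟩
    refine tendsto_of_tendsto_of_tendsto_of_le_of_le tendsto_const_nhds (h := fun n : ℕ =>
      x + 1 / ((n : ℝ) + 1)) ?_ hle fun n => ?_
    · simpa using tendsto_one_div_add_atTop_nhds_zero_nat.const_add x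
    · have := (Int.ceil_lt_add_one (x * (n + 1))).le
      have hn := hpos n
      rw [div_le_iff₀ hn]
      field_simp
      linarith
  refine measurable_of_tendsto_metrizable
    (f := fun (n : ℕ) (x : ℝ) => f (((⌈x * (n + 1)⌉ : ℤ) : ℝ) / (n + 1))) (fun n => ?_)
    (tendsto_pi_nhds.2 fun x => (hf x).tendsto.comp (happrox x))
  exact (measurable_from_top (f := fun k : ℤ => f ((k : ℝ) / (n + 1)))).comp
    (Int.measurable_ceil.comp (by fun_prop))

lemma tendsto_setIntegral_Ioc_left (F : StieltjesFunction ℝ) {g : ℝ → ℝ} {a t C : ℝ} (hat : a < t)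
    (hg : IntegrableOn g (Ioc a t) F.measure) (hC : ∀ s ∈ Ioc a t, ‖g s‖ ≤ C) :
    Tendsto (fun u => ∫ s in Ioc u t, g s ∂F.measure) (nhdsWithin t (Iio t))
      (nhds (g t * (F t - leftLim F t))) := by
  have hlim : Tendsto (fun u => C * (leftLim F t - F u)) (nhdsWithin t (Iio t)) (nhds 0) := by
    simpa using ((F.mono.tendsto_leftLim t).const_sub (leftLim F t)).const_mul C
  refine tendsto_iff_norm_sub_tendsto_zero.2 (squeeze_zero' (Eventually.of_forall fun _ =>
    norm_nonneg _) ?_ hlim)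
  filter_upwards [Ioo_mem_nhdsLT hat] with u hu
  have hsub : Ioo u t ⊆ Ioc a t := fun s hs => ⟨hu.1.trans hs.1, hs.2.le⟩
  have hreal : F.measure.real (Ioo u t) = leftLim F t - F u := by
    rw [measureReal_def, F.measure_Ioo,
      ENNReal.toReal_ofReal (sub_nonneg.2 (F.mono.le_leftLim hu.2))]
  have hsing : ∫ s in {t}, g s ∂F.measure = g t * (F t - leftLim F t) := by
    rw [integral_singleton, measureReal_def, F.measure_singleton,
      ENNReal.toReal_ofReal (sub_nonneg.2 (F.mono.leftLim_le le_rfl)), smul_eq_mul, mul_comm]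
  rw [← Ioo_union_right hu.2, setIntegral_union (by simp) (measurableSet_singleton t)
    (hg.mono_set hsub) (hg.mono_set (by simpa using hat)), hsing, add_sub_cancel_right, ← hreal]
  exact norm_setIntegral_le_of_norm_le_const (by simp [F.measure_Ioo])
    fun s hs => hC s (hsub hs)

section TaxReflection

variable {δ X V K : ℝ → ℝ} {xbar t : ℝ}

lemma IsTaxReflectionPair.eq_zero_of_leftLim_lt (h : IsTaxReflectionPair δ X xbar V K)
    (ht : 0 < t) (hK : leftLim K t < K t) : V t = 0 := by
  obtain ⟨-, hKc, hV0, hKm, -, hzero⟩ := h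
  by_contra hne
  have hmem : ({t} : Set ℝ) ⊆ {t | 0 ≤ t ∧ 0 < V t} :=
    singleton_subset_iff.2 ⟨ht.le, (hV0 t ht.le).lt_of_ne' hne⟩
  have hnull : lsMeasure K {t} = 0 := measure_mono_null hmem hzero
  rw [← Measure.restrict_apply_self, restrict_lsMeasure hKm hKc.1 (measurableSet_singleton t)
    (by simpa using ht.ne), Measure.restrict_apply_self, StieltjesFunction.measure_singleton,
    pathStieltjes_apply hKm hKc.1 ht.le,
    ← leftLim_eq_of_tendsto (tendsto_leftLim_pathStieltjes hKm hKc.1 ht),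
    ENNReal.ofReal_eq_zero] at hnull
  linarith

/-- The jump of the reflected, taxed path. -/
lemma IsTaxReflectionPair.sub_leftLim (h : IsTaxReflectionPair δ X xbar V K)
    (hδ : Measurable δ) (hδ01 : ∀ y : ℝ, 0 ≤ y → δ y ∈ Ico (0 : ℝ) 1) (hX : Cadlag X)
    (ht : 0 < t) :
    V t - leftLim V t = (X t + K t) - (leftLim X t + leftLim K t) -
      δ (V t) * (runSup xbar (fun s => X s + K s) t -
        leftLim (runSup xbar (fun s => X s + K s)) t) := by
  obtain ⟨hVc, hKc, hV0, hKm, heq, -⟩ := h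
  have hS := hX.add hKc
  have hm := monotoneOn_runSup (xbar := xbar) hS
  have hc : ∀ t : ℝ, 0 ≤ t → _ := fun t ht => continuousWithinAt_runSup_Ici (xbar := xbar) hS ht
  set F := pathStieltjes _ hm hc
  have hbound : ∀ s ∈ Ioc 0 t, ‖δ (V s)‖ ≤ 1 := fun s hs => by
    obtain ⟨h0, h1⟩ := hδ01 _ (hV0 s hs.1.le)
    rw [Real.norm_of_nonneg h0]
    exact h1.le
  have hVmeas : Measurable fun s => V (max s 0) := measurable_of_continuousWithinAt_Ici fun x =>
    (hVc.1 (max x 0) (le_max_right _ _)).comp (t := Ici (max x 0)) (by fun_prop)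
      fun y (hy : x ≤ y) => mem_Ici.2 (max_le_max_right 0 hy)
  have hint : IntegrableOn (fun s => δ (V s)) (Ioc 0 t) F.measure := by
    have hmeas : AEStronglyMeasurable (fun s => δ (V s)) (F.measure.restrict (Ioc 0 t)) := by
      refine (hδ.comp hVmeas).aestronglyMeasurable.congr ?_
      filter_upwards [ae_restrict_mem measurableSet_Ioc] with s hs
      simp [max_eq_left hs.1.le]
    exact .of_bound (by simp [F.measure_Ioc]) hmeas 1
      ((ae_restrict_iff' measurableSet_Ioc).2 (Eventually.of_forall hbound))
  have heq' : ∀ r : ℝ, 0 ≤ r →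
      V r = X r + K r - ∫ s in Ioc 0 r, δ (V s) ∂F.measure := fun r hr => by
    rw [heq r hr, restrict_lsMeasure hm hc measurableSet_Ioc (by simp)]
  have hstep : Tendsto (fun u => V t - V u) (nhdsWithin t (Iio t)) (nhds
      ((X t + K t) - (leftLim X t + leftLim K t) - δ (V t) * (F t - leftLim F t))) := by
    refine ((((hX.tendsto_leftLim ht).add (hKc.tendsto_leftLim ht)).const_sub (X t + K t)).sub
      (tendsto_setIntegral_Ioc_left F ht hint hbound)).congr' ?_
    filter_upwards [Ioo_mem_nhdsLT ht] with u hu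
    have hsplit := setIntegral_union (Ioc_disjoint_Ioc_of_le le_rfl) measurableSet_Ioc
      (hint.mono_set (Ioc_subset_Ioc_right hu.2.le)) (hint.mono_set (Ioc_subset_Ioc_left hu.1.le))
    rw [Ioc_union_Ioc_eq_Ioc hu.1.le hu.2.le] at hsplit
    rw [heq' t ht.le, heq' u hu.1.le, hsplit]
    ring
  rw [pathStieltjes_apply hm hc ht.le,
    ← leftLim_eq_of_tendsto (tendsto_leftLim_pathStieltjes hm hc ht)] at hstep
  exact tendsto_nhds_unique ((hVc.tendsto_leftLim ht).const_sub (V t)) hstep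

end TaxReflection

section RunSupJumps

variable {Z : ℝ → ℝ} {xbar t : ℝ}

lemma tendsto_leftLim_runSup (hZ : Cadlag Z) (ht : 0 < t) :
    Tendsto (runSup xbar Z) (nhdsWithin t (Iio t)) (nhds (leftLim (runSup xbar Z) t)) :=
  tendsto_leftLim_of_tendsto ⟨_, tendsto_leftLim_pathStieltjes (monotoneOn_runSup hZ)
    (fun _ hs => continuousWithinAt_runSup_Ici hZ hs) ht⟩

lemma leftLim_le_leftLim_runSup (hZ : Cadlag Z) (ht : 0 < t) :
    leftLim Z t ≤ leftLim (runSup xbar Z) t := by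
  refine le_of_tendsto_of_tendsto (hZ.tendsto_leftLim ht) (tendsto_leftLim_runSup hZ ht) ?_
  filter_upwards [Ioo_mem_nhdsLT ht] with s hs
  exact le_runSup_s10 hZ hs.1.le le_rfl

lemma leftLim_runSup_le (hZ : Cadlag Z) (ht : 0 < t) :
    leftLim (runSup xbar Z) t ≤ runSup xbar Z t := by
  refine le_of_tendsto (tendsto_leftLim_runSup hZ ht) ?_
  filter_upwards [Ioo_mem_nhdsLT ht] with s hs
  exact monotoneOn_runSup hZ hs.1.le ht.le hs.2.le

lemma runSup_le_leftLim_max (hZ : Cadlag Z) (ht : 0 < t) :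
    runSup xbar Z t ≤ max (leftLim (runSup xbar Z) t) (Z t) := by
  have hle : ∀ s, 0 ≤ s → s < t → runSup xbar Z s ≤ leftLim (runSup xbar Z) t := fun s hs hst => by
    refine ge_of_tendsto (tendsto_leftLim_runSup hZ ht) ?_
    filter_upwards [Ioo_mem_nhdsLT hst] with r hr
    exact monotoneOn_runSup hZ hs (hs.trans hr.1.le) hr.1.le
  refine (runSup_le_iff hZ ht.le).2 ⟨?_, fun s hs => ?_⟩
  · exact le_max_of_le_left ((le_max_left _ _).trans (hle 0 le_rfl ht))
  · rcases hs.2.eq_or_lt with rfl | hst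
    · exact le_max_right _ _
    · exact le_max_of_le_left ((le_runSup_s10 hZ hs.1 le_rfl).trans (hle s hs.1 hst))

lemma continuousOn_runSup (hZ : Cadlag Z) (hjumps : NoPosJumps Z) :
    ContinuousOn (runSup xbar Z) (Ici 0) := by
  intro t ht
  have hr := continuousWithinAt_runSup_Ici (xbar := xbar) hZ ht
  rcases (mem_Ici.1 ht).eq_or_lt with rfl | ht0
  · exact hr
  · have hjump : leftLim (runSup xbar Z) t = runSup xbar Z t :=
      (leftLim_runSup_le hZ ht0).antisymm <| (runSup_le_leftLim_max hZ ht0).trans <|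
        max_le le_rfl ((hjumps t ht0).trans (leftLim_le_leftLim_runSup hZ ht0))
    have hl := tendsto_leftLim_runSup (xbar := xbar) hZ ht0
    rw [hjump] at hl
    refine ContinuousAt.continuousWithinAt ?_
    rw [ContinuousAt, ← nhdsLT_sup_nhdsGE]
    exact hl.sup hr

end RunSupJumps

/-- **Jumps of `K⁺` occur only at zero of `V⁺`; `X + K⁺` has no positive jumps and its
running supremum is continuous.** -/
theorem tax_reflection_pair_jump_structure
    (δ : ℝ → ℝ) (hδmeas : Measurable δ)
    (hδ01 : ∀ y : ℝ, 0 ≤ y → δ y ∈ Set.Ico (0:ℝ) 1)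
    (X : ℝ → ℝ) (hX : Cadlag X) (hXjumps : NoPosJumps X)
    (xbar : ℝ) (hxbar : max (X 0) 0 ≤ xbar)
    (V K : ℝ → ℝ) (hVK : IsTaxReflectionPair δ X xbar V K) :
    (∀ t : ℝ, 0 < t → Function.leftLim K t < K t →
      V t = 0 ∧
      (X t - Function.leftLim X t) + (K t - Function.leftLim K t)
        = -(Function.leftLim V t) ∧
      -(Function.leftLim V t) ≤ 0) ∧
    NoPosJumps (fun t => X t + K t) ∧
    ContinuousOn (runSup xbar (fun t => X t + K t)) (Set.Ici 0) := by
  obtain ⟨hVc, hKc, hV0, hKm, -, -⟩ := id hVK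
  have hS := hX.add hKc
  have hjump : ∀ t : ℝ, 0 < t → leftLim K t < K t → V t = 0 ∧
      (X t - leftLim X t) + (K t - leftLim K t) = -(leftLim V t) ∧ -(leftLim V t) ≤ 0 := by
    intro t ht hKt
    have hVt := hVK.eq_zero_of_leftLim_lt ht hKt
    have hVl : 0 ≤ leftLim V t := by
      refine ge_of_tendsto (hVc.tendsto_leftLim ht) ?_
      filter_upwards [Ioo_mem_nhdsLT ht] with s hs
      exact hV0 s hs.1.le
    have heq := hVK.sub_leftLim hδmeas hδ01 hX ht
    have hSl := leftLim_le_leftLim_runSup (xbar := xbar) hS ht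
    have hMl := leftLim_runSup_le (xbar := xbar) hS ht
    have hM := runSup_le_leftLim_max (xbar := xbar) hS ht
    rw [hX.leftLim_add hKc ht] at hSl
    obtain ⟨hd0, hd1⟩ := hδ01 0 le_rfl
    rw [hVt] at heq
    set M := runSup xbar fun s => X s + K s
    have hflat : M t = leftLim M t := by
      refine hMl.antisymm' (not_lt.1 fun hlt => ?_)
      have hMS : M t ≤ X t + K t := (le_max_iff.1 hM).resolve_left hlt.not_ge
      nlinarith [mul_pos (sub_pos.2 hd1) (sub_pos.2 hlt)]
    rw [hflat, sub_self, mul_zero] at heq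
    exact ⟨hVt, by linarith, by linarith⟩
  have hnopos : NoPosJumps fun t => X t + K t := by
    intro t ht
    rw [hX.leftLim_add hKc ht]
    rcases lt_or_ge (leftLim K t) (K t) with hKt | hKt
    · obtain ⟨-, h1, h2⟩ := hjump t ht hKt
      linarith
    · exact add_le_add (hXjumps t ht) hKt
  exact ⟨hjump, hnopos, continuousOn_runSup hS hnopos⟩

end
end
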